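/- Let f, g : ℂ → ℂ, let φ(z) = (f(z)(1-g(z)²), i·f(z)(1+g(z)²), 2f(z)g(z)), and let Φ : ℂ → ℂ³ have complex derivative φ on a neighborhood of z₀, with φ complex differentiable at z₀. Define x(u,v) = Re Φ(u + iv). Then at (u₀, v₀) with z₀ = u₀ + iv₀, the mean curvature numerator vanishes: (x_v · x_v) x_uu − 2 (x_u · x_v) x_vv + (x_u · x_u) x_vv = 0 in ℝ³, where · is the real dot product. (Hence wherever the metric is nondegenerate, the mean curvature H of the surface x is zero, i.e., the Weierstrass Representation gives a minimal surface.) -/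

import Mathlib

/-- The Weierstrass vector `φ(z) = (f(z)(1-g(z)²), i·f(z)(1+g(z)²), 2f(z)g(z))`. -/
def weierstrassVec (f g : ℂ) : ℂ × ℂ × ℂ :=
  (f * (1 - g ^ 2), Complex.I * f * (1 + g ^ 2), 2 * f * g)

/-- Componentwise real part of a vector in ℂ³. -/
def reVec (w : ℂ × ℂ × ℂ) : ℝ × ℝ × ℝ := (w.1.re, w.2.1.re, w.2.2.re)

/-- The real dot product on ℝ³. -/
def dot3 (a b : ℝ × ℝ × ℝ) : ℝ := a.1 * b.1 + a.2.1 * b.2.1 + a.2.2 * b.2.2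

/-- `reVec` as a continuous real-linear map. -/
noncomputable def reVecCLM : ℂ × ℂ × ℂ →L[ℝ] ℝ × ℝ × ℝ :=
  Complex.reCLM.prodMap (Complex.reCLM.prodMap Complex.reCLM)

theorem HasDerivAt.reVec_comp {F : ℂ → ℂ × ℂ × ℂ} {w : ℂ × ℂ × ℂ} {γ : ℝ → ℂ} {c : ℂ} {t : ℝ}
    (hF : HasDerivAt F w (γ t)) (hγ : HasDerivAt γ c t) :
    HasDerivAt (fun s => reVec (F (γ s))) (reVec (c • w)) t :=
  reVecCLM.hasFDerivAt.comp_hasDerivAt t (hF.scomp t hγ)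

theorem hasDerivAt_horizontal_line (u v : ℝ) :
    HasDerivAt (fun s : ℝ => (s + v * Complex.I : ℂ)) 1 u :=
  (HasDerivAt.ofReal_comp (hasDerivAt_id u)).add_const _

theorem hasDerivAt_vertical_line (u v : ℝ) :
    HasDerivAt (fun s : ℝ => (u + s * Complex.I : ℂ)) Complex.I v := by
  simpa using ((HasDerivAt.ofReal_comp (hasDerivAt_id v)).mul_const Complex.I).const_add (u : ℂ)

/-- If `F` is a primitive of `φ` near `γ t` and `γ` has constant velocity `c`, this computes the
second derivative of `reVec ∘ F ∘ γ`. -/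
theorem deriv_deriv_reVec_comp {F φ : ℂ → ℂ × ℂ × ℂ} {γ : ℝ → ℂ} {c : ℂ} {t : ℝ}
    (hF : ∀ᶠ z in nhds (γ t), HasDerivAt F (φ z) z) (hφ : DifferentiableAt ℂ φ (γ t))
    (hγ : ∀ s, HasDerivAt γ c s) :
    deriv (fun s => deriv (fun r => reVec (F (γ r))) s) t =
      reVec (c • c • deriv φ (γ t)) := by
  have h : (fun s => deriv (fun r => reVec (F (γ r))) s) =ᶠ[nhds t]
      fun s => reVec (c • φ (γ s)) :=
    ((hγ t).continuousAt.eventually hF).mono fun s hs => (hs.reVec_comp (hγ s)).deriv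
  rw [h.deriv_eq]
  exact ((hφ.hasDerivAt.const_smul c).reVec_comp (hγ t)).deriv

/-- The Weierstrass vector is isotropic: its real and imaginary parts are orthogonal and of equal
length. -/
theorem dot3_weierstrassVec_rotated (f g : ℂ) :
    dot3 (reVec (Complex.I • weierstrassVec f g)) (reVec (Complex.I • weierstrassVec f g)) =
        dot3 (reVec (weierstrassVec f g)) (reVec (weierstrassVec f g)) ∧
      dot3 (reVec (weierstrassVec f g)) (reVec (Complex.I • weierstrassVec f g)) = 0 := by
  simp only [dot3, reVec, weierstrassVec, Prod.smul_mk, smul_eq_mul, pow_two]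
  constructor <;> simp <;> ring

theorem reVec_neg (w : ℂ × ℂ × ℂ) : reVec (-w) = -reVec w :=
  map_neg reVecCLM w

/-- **The Weierstrass Representation gives a minimal surface.**
Let `f, g : ℂ → ℂ`, let `φ(z) = (f(z)(1-g(z)²), i·f(z)(1+g(z)²), 2f(z)g(z))`, and let
`Φ : ℂ → ℂ³` have complex derivative `φ` on a neighborhood of `z₀ = u₀ + i v₀`, with
`φ` complex differentiable at `z₀`. For `x(u,v) = Re Φ(u + iv)`, the mean curvature
numerator `(x_v·x_v) x_uu − 2 (x_u·x_v) x_vv + (x_u·x_u) x_vv` vanishes at `(u₀, v₀)`;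
hence wherever the metric is nondegenerate the mean curvature `H` is zero. -/
theorem weierstrass_mean_curvature_numerator_eq_zero
    (f g : ℂ → ℂ) (φ Φ : ℂ → ℂ × ℂ × ℂ) (u₀ v₀ : ℝ)
    (hφdef : ∀ z : ℂ, φ z = weierstrassVec (f z) (g z))
    (hΦ : ∀ᶠ z in nhds (u₀ + v₀ * Complex.I), HasDerivAt Φ (φ z) z)
    (hφ : DifferentiableAt ℂ φ (u₀ + v₀ * Complex.I))
    (x : ℝ × ℝ → ℝ × ℝ × ℝ)
    (hx : ∀ u v : ℝ, x (u, v) = reVec (Φ (u + v * Complex.I))) :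
    (dot3 (deriv (fun v : ℝ => x (u₀, v)) v₀) (deriv (fun v : ℝ => x (u₀, v)) v₀)) •
        (deriv (fun u : ℝ => deriv (fun u' : ℝ => x (u', v₀)) u) u₀) -
      (2 * dot3 (deriv (fun u : ℝ => x (u, v₀)) u₀) (deriv (fun v : ℝ => x (u₀, v)) v₀)) •
        (deriv (fun v : ℝ => deriv (fun v' : ℝ => x (u₀, v')) v) v₀) +
      (dot3 (deriv (fun u : ℝ => x (u, v₀)) u₀) (deriv (fun u : ℝ => x (u, v₀)) u₀)) •
        (deriv (fun v : ℝ => deriv (fun v' : ℝ => x (u₀, v')) v) v₀) = 0 := by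
  have hu := deriv_deriv_reVec_comp (γ := fun s : ℝ => (s + v₀ * Complex.I : ℂ)) (t := u₀)
    hΦ hφ fun s => hasDerivAt_horizontal_line s v₀
  have hv := deriv_deriv_reVec_comp (γ := fun s : ℝ => (u₀ + s * Complex.I : ℂ)) (t := v₀)
    hΦ hφ fun s => hasDerivAt_vertical_line u₀ s
  have hu₁ := (HasDerivAt.reVec_comp (γ := fun s : ℝ => (s + v₀ * Complex.I : ℂ)) hΦ.self_of_nhds
    (hasDerivAt_horizontal_line u₀ v₀)).deriv
  have hv₁ := (HasDerivAt.reVec_comp (γ := fun s : ℝ => (u₀ + s * Complex.I : ℂ)) hΦ.self_of_nhds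
    (hasDerivAt_vertical_line u₀ v₀)).deriv
  rw [one_smul, one_smul] at hu
  rw [smul_smul, Complex.I_mul_I, neg_one_smul, reVec_neg] at hv
  rw [one_smul] at hu₁
  simp only [hx, hu, hv, hu₁, hv₁]
  rw [hφdef]
  obtain ⟨h₁, h₂⟩ := dot3_weierstrassVec_rotated
    (f (u₀ + v₀ * Complex.I)) (g (u₀ + v₀ * Complex.I))
  rw [h₁, h₂]
  simp
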